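/- Let p ≠ q be odd primes, k ≥ 1, let s be the largest integer such that q^s divides p^{2[q|p]} − 1, and let r ≥ s. Let B be a p^k-form of rank 2[q|p]·q^{r−s} with ε(B) = η(q)^{q^{r−s}}. Then every isometry ψ of B of order exactly q^r has no non-zero fixed points. -/

import Mathlib

open Matrix

/-- `minExp p q` is the least positive integer `a` such that `q ∣ p^a - 1` or `q ∣ p^a + 1`.
(This is denoted `[q|p]` in the paper.) -/
noncomputable def minExp (p q : ℕ) : ℕ :=
  sInf {a : ℕ | 0 < a ∧ (q ∣ p ^ a - 1 ∨ q ∣ p ^ a + 1)}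

/-- `eta p q` is `1` if `q ∣ p^[q|p] - 1` and `-1` otherwise. -/
noncomputable def eta (p q : ℕ) : ℤ :=
  if q ∣ p ^ minExp p q - 1 then 1 else -1

open Classical in
/-- The index `ε(B)` of a symmetric bilinear form `B` over `ℤ/p^kℤ`:
`ε₁ · ε₂`, where `ε₁ = 1` iff `det B` is a square, and
`ε₂ = -1` iff `p ≡ 3 (mod 4)` and the rank is `≡ 2 (mod 4)`. -/
noncomputable def epsilon (p : ℕ) {ι : Type*} [Fintype ι] [DecidableEq ι] {R : Type*}
    [CommRing R] (B : Matrix ι ι R) : ℤ :=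
  (if IsSquare B.det then 1 else -1) *
    (if p % 4 = 3 ∧ Fintype.card ι % 4 = 2 then -1 else 1)

lemma minExp_spec (p q : ℕ) (hp : p.Prime) (hq : q.Prime) (hpq : p ≠ q) :
    0 < minExp p q ∧ (q ∣ p ^ minExp p q - 1 ∨ q ∣ p ^ minExp p q + 1) := by
  have hne : {a : ℕ | 0 < a ∧ (q ∣ p ^ a - 1 ∨ q ∣ p ^ a + 1)}.Nonempty := by
    refine ⟨q - 1, ?_, Or.inl ?_⟩
    · have := hq.two_le; omega
    · have hc : p.Coprime q := (Nat.coprime_primes hp hq).2 hpq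
      have := Nat.ModEq.pow_totient hc
      rw [Nat.totient_prime hq] at this
      exact (Nat.modEq_iff_dvd' (Nat.one_le_pow _ _ hp.pos)).1 this.symm
  exact Nat.sInf_mem hne

lemma cast_cond (p q t : ℕ) (hp : p.Prime) :
    (q ∣ p ^ t - 1 ∨ q ∣ p ^ t + 1) ↔ ((p : ZMod q) ^ t = 1 ∨ (p : ZMod q) ^ t = -1) := by
  rw [← ZMod.natCast_eq_zero_iff, ← ZMod.natCast_eq_zero_iff,
    Nat.cast_sub (Nat.one_le_pow _ _ hp.pos)]
  push_cast
  rw [sub_eq_zero, add_eq_zero_iff_eq_neg]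

lemma minExp_dvd (p q t : ℕ) (hp : p.Prime) (hq : q.Prime) (hpq : p ≠ q)
    (h : q ∣ p ^ t - 1 ∨ q ∣ p ^ t + 1) : minExp p q ∣ t := by
  have := Fact.mk hq
  obtain ⟨ha, hd⟩ := minExp_spec p q hp hq hpq
  rw [cast_cond p q _ hp] at hd h
  by_contra hnd
  have hb : 0 < t % minExp p q := Nat.pos_of_ne_zero fun h0 => hnd (Nat.dvd_of_mod_eq_zero h0)
  have hlt := Nat.mod_lt t ha
  have : ¬ (0 < t % minExp p q ∧ (q ∣ p ^ (t % minExp p q) - 1 ∨ q ∣ p ^ (t % minExp p q) + 1)) :=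
    Nat.notMem_of_lt_sInf (m := t % minExp p q) hlt
  apply this
  refine ⟨hb, ?_⟩
  rw [cast_cond p q _ hp]
  rw [← Nat.div_add_mod t (minExp p q), pow_add, pow_mul] at h
  have h1 : ((p : ZMod q) ^ minExp p q) ^ (t / minExp p q) = 1 ∨
      ((p : ZMod q) ^ minExp p q) ^ (t / minExp p q) = -1 := by
    rcases hd with hd | hd
    · left; rw [hd, one_pow]
    · rw [hd]; exact neg_one_pow_eq_or _ _
  rcases h1 with h1 | h1 <;> rw [h1] at h
  · simpa using h
  · rcases h with h | h
    · right; linear_combination -h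
    · left; linear_combination -h

lemma key_nt (p q : ℕ) (hp : p.Prime) (hq : q.Prime) (hq2 : q ≠ 2)
    (hpq : p ≠ q) (s : ℕ) 
    (hs' : ¬ q ^ (s + 1) ∣ p ^ (2 * minExp p q) - 1)
    (r : ℕ) (hr1 : 1 ≤ r) (t : ℕ) (ht : 0 < t)
    (h : q ^ r ∣ p ^ t - 1 ∨ q ^ r ∣ p ^ t + 1) : minExp p q * q ^ (r - s) ∣ t := by
  have := Fact.mk hq
  obtain ⟨ha, hd⟩ := minExp_spec p q hp hq hpq
  have hqr : q ∣ q ^ r := dvd_pow_self q (by omega)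
  have h' := h.imp (fun x => hqr.trans x) (fun x => hqr.trans x)
  obtain ⟨c, rfl⟩ := minExp_dvd p q t hp hq hpq h'
  have hc : c ≠ 0 := by rintro rfl; simp at ht
  have key : ∀ t u, (u ∣ p ^ t - 1 ∨ u ∣ p ^ t + 1) → u ∣ p ^ (2 * t) - 1 := by
    intro t u hu
    have : p ^ (2 * t) - 1 = (p ^ t + 1) * (p ^ t - 1) := by
      rw [mul_comm 2 t, pow_mul, ← Nat.sq_sub_sq, one_pow]
    rw [this]
    rcases hu with hu | hu
    · exact hu.mul_left _
    · exact hu.mul_right _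
  have h2 := key _ _ h
  have h3 := key _ _ hd
  have hlt : ∀ e, 0 < e → 1 < p ^ e := fun e he => Nat.one_lt_pow he.ne' hp.one_lt
  have hnd : ¬ q ∣ p ^ (2 * minExp p q) := fun hh =>
    hpq ((Nat.prime_dvd_prime_iff_eq hq hp).1 (hq.dvd_of_dvd_pow hh)).symm
  have lte := padicValNat.pow_sub_pow (p := q) (x := p ^ (2 * minExp p q)) (y := 1) (n := c)
    (hq.odd_of_ne_two hq2) (hlt _ (by omega)) h3 hnd hc
  rw [one_pow, ← pow_mul, mul_assoc] at lte
  have hA : p ^ (2 * minExp p q) - 1 ≠ 0 := by have := hlt (2 * minExp p q) (by omega); omega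
  have hB : p ^ (2 * (minExp p q * c)) - 1 ≠ 0 := by
    have := hlt (2 * (minExp p q * c)) (by omega); omega
  rw [padicValNat_dvd_iff_le hB] at h2
  rw [padicValNat_dvd_iff_le hA] at hs'
  exact mul_dvd_mul_left _ ((padicValNat_dvd_iff_le hc).2 (by omega))

lemma inj_aux {K : Type*} [Field K] (p q : ℕ) (hp : p.Prime) (hq : q.Prime) (hq2 : q ≠ 2)
    (hpq : p ≠ q) (s : ℕ)
    (hs' : ¬ q ^ (s + 1) ∣ p ^ (2 * minExp p q) - 1)
    (r : ℕ) (hr1 : 1 ≤ r) (μ : K) (hμ : orderOf μ = q ^ r) (i j : ℕ) (hij : i ≤ j)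
    (hj : j < minExp p q * q ^ (r - s)) :
    (μ ^ p ^ i = μ ^ p ^ j → i = j) ∧ μ ^ p ^ i ≠ (μ ^ p ^ j)⁻¹ := by
  obtain ⟨t, rfl⟩ := Nat.exists_eq_add_of_le hij
  have hν : orderOf (μ ^ p ^ i) = q ^ r := by
    rw [Nat.Coprime.orderOf_pow, hμ]
    rw [hμ]
    exact Nat.Coprime.pow _ _ ((Nat.coprime_primes hq hp).2 hpq.symm)
  have hμ0 : μ ≠ 0 := by
    rintro rfl
    rw [orderOf_eq_zero_iff'.2] at hμ
    · exact (pow_pos hq.pos r).ne hμ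
    · intro n hn; simp [hn.ne']
  rw [pow_add, pow_mul]
  generalize hν' : μ ^ p ^ i = ν at *
  have hν0 : ν ≠ 0 := by rw [← hν']; exact pow_ne_zero _ hμ0
  have hkey : 0 < t → ¬ (q ^ r ∣ p ^ t - 1 ∨ q ^ r ∣ p ^ t + 1) := fun ht hh => by
    have := Nat.le_of_dvd ht (key_nt p q hp hq hq2 hpq s hs' r hr1 t ht hh)
    omega
  constructor
  · intro h
    rcases Nat.eq_zero_or_pos t with ht | ht
    · omega
    · refine absurd (Or.inl ?_) (hkey ht)
      rw [← hν, orderOf_dvd_iff_pow_eq_one]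
      apply mul_right_cancel₀ hν0
      rw [← pow_succ, Nat.sub_add_cancel (Nat.one_le_pow _ _ hp.pos), ← h, one_mul]
  · intro h
    have h1 : q ^ r ∣ p ^ t + 1 := by
      rw [← hν, orderOf_dvd_iff_pow_eq_one, pow_succ]
      rw [h] 
      rw [← h]
      nth_rewrite 2 [h]
      exact mul_inv_cancel₀ (pow_ne_zero _ hν0)
    rcases Nat.eq_zero_or_pos t with ht | ht
    · subst ht
      have : q ∣ 2 := (dvd_pow_self q (by omega)).trans h1
      exact hq2 ((Nat.prime_dvd_prime_iff_eq hq Nat.prime_two).1 this)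
    · exact hkey ht (Or.inr h1)

open Polynomial in
lemma exists_eig {K : Type*} [Field K] [IsAlgClosed K] (n q r : ℕ) (hq : q.Prime)
    (hqK : (q : K) ≠ 0) (hr1 : 1 ≤ r) (A : Matrix (Fin n) (Fin n) K) (hA : A ^ q ^ r = 1)
    (hA' : A ^ q ^ (r - 1) ≠ 1) : ∃ μ : K, A.charpoly.eval μ = 0 ∧ orderOf μ = q ^ r := by
  obtain ⟨e, rfl⟩ : ∃ e, r = e + 1 := ⟨r - 1, by omega⟩
  simp only [Nat.add_sub_cancel] at hA'
  set G : K[X] := ∑ i ∈ Finset.range q, (X ^ q ^ e) ^ i with hG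
  have hGA : aeval A G = ∑ i ∈ Finset.range q, (A ^ q ^ e) ^ i := by simp [hG]
  have hmul : aeval A G * (A ^ q ^ e - 1) = 0 := by
    rw [hGA, geom_sum_mul, ← pow_mul, ← pow_succ, hA, sub_self]
  have hnu : ¬ IsUnit (aeval A G) := by
    intro hu
    rw [hu.mul_right_eq_zero, sub_eq_zero] at hmul
    exact hA' hmul
  have hne : Nontrivial (Matrix (Fin n) (Fin n) K) := ⟨_, _, hA'⟩
  have h0 : (0 : K) ∈ spectrum K (aeval A G) := by
    rwa [spectrum.zero_mem_iff]
  have hGdeg : G ≠ 0 := by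
    intro h
    have := congrArg (eval 1) h
    simp [hG, eval_finsetSum] at this
    exact hqK this
  have hdeg : 0 < G.degree := by
    by_contra hd
    have := eq_C_of_degree_le_zero (not_lt.1 hd)
    rw [this, aeval_C] at hnu
    apply hnu
    apply IsUnit.map
    rw [isUnit_iff_ne_zero]
    intro h
    rw [h, C_0] at this
    exact hGdeg this
  rw [spectrum.map_polynomial_aeval_of_degree_pos A G hdeg] at h0
  obtain ⟨μ, hμ, hGμ⟩ := h0
  have hGμ' : ∑ i ∈ Finset.range q, (μ ^ q ^ e) ^ i = 0 := by
    simpa [hG, eval_finsetSum] using hGμ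
  refine ⟨μ, ?_, ?_⟩
  · rw [Matrix.mem_spectrum_iff_isRoot_charpoly] at hμ
    exact hμ
  · have := Fact.mk hq
    apply orderOf_eq_prime_pow
    · intro h
      rw [h] at hGμ'
      simp at hGμ'
      exact hqK hGμ'
    · have := geom_sum_mul (μ ^ q ^ e) q
      rw [hGμ', zero_mul] at this
      rw [pow_succ, pow_mul]
      exact (sub_eq_zero.1 this.symm)

lemma inv_root {K : Type*} [Field K] (n : ℕ) (A B : Matrix (Fin n) (Fin n) K)
    (hB : B.det ≠ 0) (h : Aᵀ * B * A = B) (μ : K) (hμ0 : μ ≠ 0)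
    (hμ : A.charpoly.eval μ = 0) : A.charpoly.eval μ⁻¹ = 0 := by
  rw [Matrix.eval_charpoly] at *
  have hA : A.det ≠ 0 := by
    intro h0
    have := congrArg det h
    rw [det_mul, h0, mul_zero] at this
    exact hB this.symm
  have e : Aᵀ * B * (scalar (Fin n) μ⁻¹ - A) = (-μ⁻¹) • ((scalar (Fin n) μ - A)ᵀ * B) := by
    rw [mul_sub, h]
    simp only [scalar_apply, ← smul_one_eq_diagonal, transpose_sub, transpose_smul, transpose_one,
      sub_mul, Matrix.smul_mul, Matrix.mul_smul, one_mul, mul_one, smul_sub, smul_smul]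
    simp [hμ0]
    abel
  have := congrArg det e
  rw [det_smul, det_mul, det_mul, det_mul, det_transpose, det_transpose, hμ] at this
  simpa [hA, hB] using this

lemma frob_root {p : ℕ} [Fact p.Prime] {K : Type*} [Field K] [Algebra (ZMod p) K]
    (f : Polynomial (ZMod p)) (μ : K) (h : Polynomial.aeval μ f = 0) (i : ℕ) :
    Polynomial.aeval (μ ^ p ^ i) f = 0 := by
  induction i with
  | zero => simpa using h
  | succ i ih =>
    rw [pow_succ, pow_mul, ← Polynomial.expand_aeval, ZMod.expand_card, map_pow, ih,
      zero_pow (Fact.out : p.Prime).ne_zero]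

lemma isUnit_of_castHom (p k : ℕ) (hp : p.Prime) (f : ZMod (p ^ k) →+* ZMod p)
    (x : ZMod (p ^ k)) (hx : f x ≠ 0) : IsUnit x := by
  haveI : NeZero (p ^ k) := ⟨pow_ne_zero _ hp.ne_zero⟩
  rw [← ZMod.natCast_zmod_val x] at hx ⊢
  rw [map_natCast, Ne, ZMod.natCast_eq_zero_iff] at hx
  rw [ZMod.isUnit_iff_coprime]
  exact Nat.Coprime.pow_right _ ((Nat.Prime.coprime_iff_not_dvd hp).2 hx).symm

lemma lift_one (p q k n : ℕ) (hp : p.Prime) (hq : q.Prime) (hpq : p ≠ q)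
    (f : ZMod (p ^ k) →+* ZMod p) (M : Matrix (Fin n) (Fin n) (ZMod (p ^ k)))
    (hM : M ^ q = 1) (h1 : f.mapMatrix M = 1) : M = 1 := by
  have := Fact.mk hp
  have hu : IsUnit (∑ i ∈ Finset.range q, M ^ i) := by
    rw [Matrix.isUnit_iff_isUnit_det]
    apply isUnit_of_castHom p k hp f
    rw [RingHom.map_det, map_sum]
    simp only [map_pow, h1, one_pow, Finset.sum_const, Finset.card_range]
    rw [← Nat.cast_smul_eq_nsmul (ZMod p), det_smul, det_one, mul_one]
    apply pow_ne_zero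
    rw [Ne, ZMod.natCast_eq_zero_iff]
    exact fun hh => hpq ((Nat.prime_dvd_prime_iff_eq hp hq).1 hh)
  have := geom_sum_mul M q
  rw [hM, sub_self, hu.mul_right_eq_zero, sub_eq_zero] at this
  exact this

theorem stmt18 (p q : ℕ) (hp : p.Prime) (hq : q.Prime) (hp2 : p ≠ 2) (hq2 : q ≠ 2)
    (hpq : p ≠ q) (k : ℕ) (hk : 1 ≤ k)
    (s : ℕ) (hs : q ^ s ∣ p ^ (2 * minExp p q) - 1)
    (hs' : ¬ q ^ (s + 1) ∣ p ^ (2 * minExp p q) - 1)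
    (r : ℕ) (hr : s ≤ r) (n : ℕ) (hn : n = 2 * minExp p q * q ^ (r - s))
    (B : Matrix (Fin n) (Fin n) (ZMod (p ^ k))) (hsymm : B.IsSymm) (hdet : IsUnit B.det)
    (heps : epsilon p B = eta p q ^ q ^ (r - s))
    (ψ : Matrix (Fin n) (Fin n) (ZMod (p ^ k))) (hiso : ψᵀ * B * ψ = B)
    (hord : orderOf ψ = q ^ r) :
    ∀ x : Fin n → ZMod (p ^ k), ψ.mulVec x = x → x = 0 := by
  classical
  have := Fact.mk hp
  have hs1 : 1 ≤ s := by
    by_contra h0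
    obtain rfl : s = 0 := by omega
    apply hs'
    have : p ^ (2 * minExp p q) - 1 = (p ^ minExp p q + 1) * (p ^ minExp p q - 1) := by
      rw [mul_comm 2, pow_mul, ← Nat.sq_sub_sq, one_pow]
    rw [this, zero_add, pow_one]
    rcases (minExp_spec p q hp hq hpq).2 with h | h
    · exact h.mul_left _
    · exact h.mul_right _
  have hr1 : 1 ≤ r := hs1.trans hr
  set f : ZMod (p ^ k) →+* ZMod p := ZMod.castHom (dvd_pow_self p (by omega)) (ZMod p) with hf
  let K := AlgebraicClosure (ZMod p)
  let g : ZMod (p ^ k) →+* K := (algebraMap (ZMod p) K).comp f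
  set φ := f.mapMatrix ψ with hφ
  set A : Matrix (Fin n) (Fin n) K := (algebraMap (ZMod p) K).mapMatrix φ with hA
  have hφ1 : φ ^ q ^ r = 1 := by rw [hφ, ← map_pow, ← hord, pow_orderOf_eq_one, map_one]
  have hφ2 : φ ^ q ^ (r - 1) ≠ 1 := by
    intro h
    rw [hφ, ← map_pow] at h
    have h2 := lift_one p q k n hp hq hpq f _ (by
      rw [← pow_mul, ← pow_succ, Nat.sub_add_cancel hr1, ← hord, pow_orderOf_eq_one]) h
    have := orderOf_dvd_of_pow_eq_one h2
    rw [hord, Nat.pow_dvd_pow_iff_le_right hq.one_lt] at this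
    omega
  have hinj : Function.Injective ((algebraMap (ZMod p) K).mapMatrix (m := Fin n)) :=
    Matrix.map_injective (algebraMap (ZMod p) K).injective
  have hA1 : A ^ q ^ r = 1 := by rw [hA, ← map_pow, hφ1, map_one]
  have hA2 : A ^ q ^ (r - 1) ≠ 1 := by
    intro h
    rw [hA, ← map_pow, ← map_one (algebraMap (ZMod p) K).mapMatrix] at h
    exact hφ2 (hinj h)
  have hqK : (q : K) ≠ 0 := by
    rw [← map_natCast (algebraMap (ZMod p) K), Ne, map_eq_zero, ZMod.natCast_eq_zero_iff]
    exact fun hh => hpq ((Nat.prime_dvd_prime_iff_eq hp hq).1 hh)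
  obtain ⟨μ, hμ, hμo⟩ := exists_eig n q r hq hqK hr1 A hA1 hA2
  have hcp : A.charpoly = φ.charpoly.map (algebraMap (ZMod p) K) := Matrix.charpoly_map _ _
  have hfr : ∀ i, A.charpoly.eval (μ ^ p ^ i) = 0 := by
    intro i
    rw [hcp, Polynomial.eval_map_algebraMap] at hμ ⊢
    exact frob_root _ _ hμ i
  have hμ0 : μ ≠ 0 := by
    rintro rfl
    rw [orderOf_eq_zero_iff'.2] at hμo
    · exact (pow_pos hq.pos r).ne hμo
    · intro n hn; simp [hn.ne']
  have hiso' : Aᵀ * g.mapMatrix B * A = g.mapMatrix B := by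
    have := congrArg g.mapMatrix hiso
    rw [map_mul, map_mul] at this
    exact this
  have hBd : (g.mapMatrix B).det ≠ 0 := by
    rw [← RingHom.map_det]
    exact (hdet.map g).ne_zero
  have hin : ∀ i, A.charpoly.eval (μ ^ p ^ i)⁻¹ = 0 := fun i =>
    inv_root n A _ hBd hiso' _ (pow_ne_zero _ hμ0) (hfr i)
  have hone : φ.charpoly.eval 1 ≠ 0 := by
    intro h1
    have h1' : A.charpoly.eval 1 = 0 := by
      rw [hcp, Polynomial.eval_one_map, h1, map_zero]
    set m := minExp p q * q ^ (r - s) with hm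
    let F : Option (Fin m × Bool) → K := fun o => match o with
      | none => 1
      | some (i, true) => μ ^ p ^ (i : ℕ)
      | some (i, false) => (μ ^ p ^ (i : ℕ))⁻¹
    have hroot : ∀ o, A.charpoly.IsRoot (F o) := by
      rintro (_ | ⟨i, _ | _⟩)
      · exact h1'
      · exact hin i
      · exact hfr i
    have hne1 : ∀ i, μ ^ p ^ i ≠ 1 := by
      intro i h
      have := orderOf_dvd_of_pow_eq_one h
      rw [hμo] at this
      have := (dvd_pow_self q (by omega : r ≠ 0)).trans this
      exact hpq ((Nat.prime_dvd_prime_iff_eq hq hp).1 (hq.dvd_of_dvd_pow this)).symm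
    have haux : ∀ i j : Fin m, (μ ^ p ^ (i : ℕ) = μ ^ p ^ (j : ℕ) → i = j) ∧
        μ ^ p ^ (i : ℕ) ≠ (μ ^ p ^ (j : ℕ))⁻¹ := by
      intro i j
      rcases le_total (i : ℕ) j with hij | hij
      · have := inj_aux p q hp hq hq2 hpq s hs' r hr1 μ hμo i j hij j.2
        exact ⟨fun h => Fin.ext (this.1 h), this.2⟩
      · have := inj_aux p q hp hq hq2 hpq s hs' r hr1 μ hμo j i hij i.2
        exact ⟨fun h => Fin.ext (this.1 h.symm).symm, fun h => this.2 (by rw [h, inv_inv])⟩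
    have hF : Function.Injective F := by
      rintro (_ | ⟨i, _ | _⟩) (_ | ⟨j, _ | _⟩) h
      · rfl
      · exact absurd (inv_eq_one.1 h.symm) (hne1 j)
      · exact absurd h.symm (hne1 j)
      · exact absurd (inv_eq_one.1 h) (hne1 i)
      · rw [(haux i j).1 (inv_injective h)]
      · exact absurd h.symm (haux j i).2
      · exact absurd h (hne1 i)
      · exact absurd h (haux i j).2
      · rw [(haux i j).1 h]
    have hsub : Finset.univ.image F ⊆ A.charpoly.roots.toFinset := by
      intro y hy
      obtain ⟨o, -, rfl⟩ := Finset.mem_image.1 hy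
      rw [Multiset.mem_toFinset, Polynomial.mem_roots A.charpoly_monic.ne_zero]
      exact hroot o
    have hc := Finset.card_le_card hsub
    rw [Finset.card_image_of_injective _ hF] at hc
    have hc2 := hc.trans ((Multiset.toFinset_card_le _).trans (Polynomial.card_roots' _))
    rw [Matrix.charpoly_natDegree_eq_dim] at hc2
    simp at hc2
    rw [mul_assoc, ← hm] at hn
    omega
  have hunit : IsUnit (1 - ψ) := by
    rw [Matrix.isUnit_iff_isUnit_det]
    apply isUnit_of_castHom p k hp f
    rw [RingHom.map_det, map_sub, map_one, ← hφ]
    rwa [Matrix.eval_charpoly, map_one] at hone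
  intro x hx
  obtain ⟨u, hu⟩ := hunit
  have h0 : (1 - ψ).mulVec x = 0 := by rw [sub_mulVec, one_mulVec, hx, sub_self]
  have := congrArg (fun y => ((u⁻¹ : (Matrix (Fin n) (Fin n) (ZMod (p ^ k)))ˣ) : Matrix (Fin n) (Fin n) (ZMod (p ^ k))).mulVec y) h0
  simpa [← hu, mulVec_mulVec] using this
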